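/- For every τ > 0 and x > 0, the derivative of the horseshoe penalty admits the ratio-of-Laplace-transforms representation pen'_HS(x) = ( ∫₀^∞ (u/τ) exp(−u x/τ) D₊(u/√2) du ) / ( ∫₀^∞ exp(−u x/τ) D₊(u/√2) du ), both integrals being finite and the denominator positive. -/

import Mathlib

open MeasureTheory Real Set

/-- The Dawson function `D₊(z) = exp(-z²) ∫₀^z exp(t²) dt`. -/
noncomputable def dawson (z : ℝ) : ℝ := Real.exp (-z ^ 2) * ∫ t in (0:ℝ)..z, Real.exp (t ^ 2)

/-- The marginal horseshoe density with global scale `τ`. -/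
noncomputable def pHS (τ x : ℝ) : ℝ :=
  ∫ l in Set.Ioi (0:ℝ),
    (Real.sqrt (2 * Real.pi))⁻¹ * (l * τ)⁻¹ * Real.exp (-x ^ 2 / (2 * l ^ 2 * τ ^ 2)) *
      ((2 / Real.pi) * (1 + l ^ 2)⁻¹)

theorem hasDerivAt_dawson (z : ℝ) : HasDerivAt dawson (1 - 2 * z * dawson z) z := by
  have h₁ : HasDerivAt (fun z : ℝ => Real.exp (-z ^ 2)) (Real.exp (-z ^ 2) * (-(2 * z))) z := by
    simpa using ((hasDerivAt_pow 2 z).neg).exp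
  have hc : Continuous fun t : ℝ => Real.exp (t ^ 2) := by fun_prop
  have h₂ := hc.integral_hasStrictDerivAt 0 z |>.hasDerivAt
  have h₃ : Real.exp (-z ^ 2) * Real.exp (z ^ 2) = 1 := by simp [← Real.exp_add]
  refine (h₁.mul h₂).congr_deriv ?_
  rw [h₃, dawson]
  ring

theorem continuous_dawson : Continuous dawson :=
  continuous_iff_continuousAt.2 fun z => (hasDerivAt_dawson z).continuousAt

theorem dawson_pos {z : ℝ} (hz : 0 < z) : 0 < dawson z :=
  mul_pos (Real.exp_pos _) <| intervalIntegral.intervalIntegral_pos_of_pos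
    (Continuous.intervalIntegrable (by fun_prop) _ _) (fun _ => Real.exp_pos _) hz

theorem integrable_exp_neg_sq : Integrable fun t : ℝ => Real.exp (-t ^ 2) := by
  simpa using integrable_exp_neg_mul_sq one_pos

theorem integrable_mul_exp_neg_sq : Integrable fun t : ℝ => t * Real.exp (-t ^ 2) := by
  simpa using integrable_mul_exp_neg_mul_sq one_pos

theorem integrable_exp_neg_sq_mul_sin (z : ℝ) :
    Integrable fun t : ℝ => Real.exp (-t ^ 2) * Real.sin (2 * z * t) :=
  integrable_exp_neg_sq.mul_bdd (c := 1) (by fun_prop)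
    (ae_of_all _ fun t => Real.abs_sin_le_one _)

theorem integrable_mul_exp_neg_sq_mul_cos (z : ℝ) :
    Integrable fun t : ℝ => t * Real.exp (-t ^ 2) * Real.cos (2 * z * t) :=
  integrable_mul_exp_neg_sq.mul_bdd (c := 1) (by fun_prop)
    (ae_of_all _ fun t => Real.abs_cos_le_one _)

theorem integral_mul_exp_neg_sq_mul_cos (z : ℝ) :
    ∫ t in Ioi (0 : ℝ), 2 * (t * Real.exp (-t ^ 2) * Real.cos (2 * z * t)) =
      1 - 2 * z * ∫ t in Ioi (0 : ℝ), Real.exp (-t ^ 2) * Real.sin (2 * z * t) := by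
  have hi₁ := ((integrable_mul_exp_neg_sq_mul_cos z).const_mul 2).integrableOn (s := Ioi 0)
  have hi₂ := ((integrable_exp_neg_sq_mul_sin z).const_mul (2 * z)).integrableOn (s := Ioi 0)
  have hd : ∀ t ∈ Ici (0 : ℝ),
      HasDerivAt (fun t : ℝ => -(Real.exp (-t ^ 2) * Real.cos (2 * z * t)))
        (2 * (t * Real.exp (-t ^ 2) * Real.cos (2 * z * t)) +
          2 * z * (Real.exp (-t ^ 2) * Real.sin (2 * z * t))) t := by
    intro t _
    have h₁ : HasDerivAt (fun t : ℝ => Real.exp (-t ^ 2)) (Real.exp (-t ^ 2) * (-(2 * t))) t := by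
      simpa using ((hasDerivAt_pow 2 t).neg).exp
    have h₂ : HasDerivAt (fun t : ℝ => Real.cos (2 * z * t))
        (-Real.sin (2 * z * t) * (2 * z)) t := by
      simpa using ((hasDerivAt_id t).const_mul (2 * z)).cos
    exact (h₁.mul h₂).neg.congr_deriv (by ring)
  have hlim : Filter.Tendsto (fun t : ℝ => -(Real.exp (-t ^ 2) * Real.cos (2 * z * t)))
      Filter.atTop (nhds 0) := by
    have h : Filter.Tendsto (fun t : ℝ => Real.exp (-t ^ 2)) Filter.atTop (nhds 0) :=
      Real.tendsto_exp_neg_atTop_nhds_zero.comp (Filter.tendsto_pow_atTop two_ne_zero)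
    refine squeeze_zero_norm (fun t => ?_) h
    rw [norm_neg, norm_mul, Real.norm_of_nonneg (Real.exp_pos _).le]
    exact mul_le_of_le_one_right (Real.exp_pos _).le (Real.abs_cos_le_one _)
  have h := integral_Ioi_of_hasDerivAt_of_tendsto' hd (hi₁.add hi₂) hlim
  rw [integral_add hi₁ hi₂, integral_const_mul (2 * z)] at h
  norm_num at h
  linarith

theorem hasDerivAt_integral_exp_neg_sq_mul_sin (z : ℝ) :
    HasDerivAt (fun z : ℝ => ∫ t in Ioi (0 : ℝ), Real.exp (-t ^ 2) * Real.sin (2 * z * t))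
      (1 - 2 * z * ∫ t in Ioi (0 : ℝ), Real.exp (-t ^ 2) * Real.sin (2 * z * t)) z := by
  rw [← integral_mul_exp_neg_sq_mul_cos]
  refine (hasDerivAt_integral_of_dominated_loc_of_deriv_le (s := univ)
    (bound := fun t => ‖2 * (t * Real.exp (-t ^ 2))‖)
    (F' := fun z t => 2 * (t * Real.exp (-t ^ 2) * Real.cos (2 * z * t)))
    Filter.univ_mem (Filter.Eventually.of_forall fun z => ?_) ?_ ?_ ?_ ?_ ?_).2
  · exact Continuous.aestronglyMeasurable (by fun_prop)
  · exact (integrable_exp_neg_sq_mul_sin z).integrableOn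
  · exact Continuous.aestronglyMeasurable (by fun_prop)
  · refine ae_of_all _ fun t z _ => ?_
    rw [← mul_assoc, norm_mul]
    exact mul_le_of_le_one_right (norm_nonneg _) (Real.abs_cos_le_one _)
  · exact (integrable_mul_exp_neg_sq.const_mul 2).norm.integrableOn
  · refine ae_of_all _ fun t z _ => ?_
    have h : HasDerivAt (fun z : ℝ => Real.sin (2 * z * t)) (Real.cos (2 * z * t) * (2 * t)) z := by
      simpa using (((hasDerivAt_id z).const_mul 2).mul_const t).sin
    exact (h.const_mul _).congr_deriv (by ring)

/-- The sine-transform representation of the Dawson function. -/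
theorem dawson_eq_integral_sin (z : ℝ) :
    dawson z = ∫ t in Ioi (0 : ℝ), Real.exp (-t ^ 2) * Real.sin (2 * z * t) := by
  have hd : ∀ z : ℝ, HasDerivAt (fun z : ℝ => Real.exp (z ^ 2) *
      (dawson z - ∫ t in Ioi (0 : ℝ), Real.exp (-t ^ 2) * Real.sin (2 * z * t))) 0 z := by
    intro z
    have h₁ : HasDerivAt (fun z : ℝ => Real.exp (z ^ 2)) (Real.exp (z ^ 2) * (2 * z)) z := by
      simpa using (hasDerivAt_pow 2 z).exp
    exact (h₁.mul ((hasDerivAt_dawson z).sub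
      (hasDerivAt_integral_exp_neg_sq_mul_sin z))).congr_deriv (by simp only [Pi.sub_apply]; ring)
  have h := is_const_of_deriv_eq_zero (fun z => (hd z).differentiableAt)
    (fun z => (hd z).deriv) z 0
  simpa [dawson, sub_eq_zero] using h

theorem abs_dawson_le (z : ℝ) : |dawson z| ≤ ∫ t in Ioi (0 : ℝ), Real.exp (-t ^ 2) := by
  rw [dawson_eq_integral_sin, ← Real.norm_eq_abs]
  refine norm_integral_le_of_norm_le integrable_exp_neg_sq.integrableOn (ae_of_all _ fun t => ?_)
  rw [norm_mul, Real.norm_of_nonneg (Real.exp_pos _).le]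
  exact mul_le_of_le_one_right (Real.exp_pos _).le (Real.abs_sin_le_one _)

theorem integrableOn_exp_neg_mul_div {τ x : ℝ} (hτ : 0 < τ) (hx : 0 < x) :
    IntegrableOn (fun u : ℝ => Real.exp (-u * x / τ)) (Ioi 0) := by
  refine (integrableOn_exp_mul_Ioi (a := -(x / τ)) (by simpa using div_pos hx hτ) 0).congr_fun
    (fun u _ => ?_) measurableSet_Ioi
  ring_nf

theorem integrableOn_mul_exp_neg_mul_div {τ x : ℝ} (hτ : 0 < τ) (hx : 0 < x) :
    IntegrableOn (fun u : ℝ => u * Real.exp (-u * x / τ)) (Ioi 0) := by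
  refine (integrableOn_rpow_mul_exp_neg_mul_rpow (p := 1) (s := 1) (b := x / τ) (by norm_num)
    one_pos (div_pos hx hτ)).congr_fun (fun u _ => ?_) measurableSet_Ioi
  simp only [Real.rpow_one]
  ring_nf

/-- Differentiation under the integral sign for Laplace transforms of bounded functions. -/
theorem hasDerivAt_laplace_of_bounded {f : ℝ → ℝ} (hf : Continuous f) {C : ℝ}
    (hC : ∀ u, |f u| ≤ C) {τ x : ℝ} (hτ : 0 < τ) (hx : 0 < x) :
    IntegrableOn (fun u => -(u / τ * Real.exp (-u * x / τ) * f u)) (Ioi 0) ∧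
    HasDerivAt (fun x => ∫ u in Ioi (0 : ℝ), Real.exp (-u * x / τ) * f u)
      (∫ u in Ioi (0 : ℝ), -(u / τ * Real.exp (-u * x / τ) * f u)) x := by
  refine hasDerivAt_integral_of_dominated_loc_of_deriv_le (s := Ioi (x / 2))
    (bound := fun u => C / τ * (u * Real.exp (-u * (x / 2) / τ)))
    (F' := fun x u => -(u / τ * Real.exp (-u * x / τ) * f u))
    (Ioi_mem_nhds (by linarith)) (Filter.Eventually.of_forall fun z => ?_) ?_ ?_ ?_ ?_ ?_
  · exact Continuous.aestronglyMeasurable (by fun_prop)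
  · exact Integrable.mul_bdd (integrableOn_exp_neg_mul_div hτ hx) (c := C)
      hf.aestronglyMeasurable (ae_of_all _ hC)
  · exact Continuous.aestronglyMeasurable (by fun_prop)
  · refine (ae_restrict_iff' measurableSet_Ioi).2 (ae_of_all _ fun u hu z hz => ?_)
    have hu' : 0 < u := hu
    have hz' : x / 2 < z := hz
    rw [norm_neg, norm_mul, Real.norm_of_nonneg (by positivity)]
    calc u / τ * Real.exp (-u * z / τ) * ‖f u‖
        ≤ u / τ * Real.exp (-u * (x / 2) / τ) * C := by
          refine mul_le_mul (mul_le_mul_of_nonneg_left (Real.exp_le_exp.2 ?_) (by positivity))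
            (hC u) (norm_nonneg _) (by positivity)
          refine div_le_div_of_nonneg_right ?_ hτ.le
          nlinarith
      _ = _ := by ring
  · exact (integrableOn_mul_exp_neg_mul_div hτ (half_pos hx)).const_mul _
  · refine ae_of_all _ fun u z _ => ?_
    have h : HasDerivAt (fun z : ℝ => Real.exp (-u * z / τ))
        (Real.exp (-u * z / τ) * (-u / τ)) z := by
      simpa using (((hasDerivAt_id z).const_mul (-u)).div_const τ).exp
    exact (h.mul_const _).congr_deriv (by ring)

theorem integral_exp_neg_mul_mul_sin {y : ℝ} (hy : 0 < y) (a : ℝ) :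
    ∫ u in Ioi (0 : ℝ), Real.exp (-u * y) * Real.sin (a * u) = a / (y ^ 2 + a ^ 2) := by
  have hne : y ^ 2 + a ^ 2 ≠ 0 := by positivity
  have hexp : IntegrableOn (fun u : ℝ => Real.exp (-u * y)) (Ioi 0) := by
    simpa using integrableOn_exp_neg_mul_div one_pos hy
  have hi : IntegrableOn (fun u : ℝ => Real.exp (-u * y) * Real.sin (a * u)) (Ioi 0) :=
    Integrable.mul_bdd hexp (c := 1) (Continuous.aestronglyMeasurable (by fun_prop))
      (ae_of_all _ fun t => Real.abs_sin_le_one _)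
  have hd : ∀ u ∈ Ici (0 : ℝ), HasDerivAt (fun u : ℝ => Real.exp (-u * y) *
      (-(y * Real.sin (a * u) + a * Real.cos (a * u)) / (y ^ 2 + a ^ 2)))
      (Real.exp (-u * y) * Real.sin (a * u)) u := by
    intro u _
    have h₀ : HasDerivAt (fun u : ℝ => a * u) a u := by
      simpa using (hasDerivAt_id u).const_mul a
    have h₁ : HasDerivAt (fun u : ℝ => Real.exp (-u * y)) (Real.exp (-u * y) * (-y)) u := by
      simpa using ((hasDerivAt_id u).neg.mul_const y).exp
    refine (h₁.mul (((h₀.sin.const_mul y).add (h₀.cos.const_mul a)).neg.div_const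
      (y ^ 2 + a ^ 2))).congr_deriv ?_
    simp only [Pi.add_apply, Pi.neg_apply]
    field_simp
    ring
  have hlim : Filter.Tendsto (fun u : ℝ => Real.exp (-u * y) *
      (-(y * Real.sin (a * u) + a * Real.cos (a * u)) / (y ^ 2 + a ^ 2)))
      Filter.atTop (nhds 0) := by
    have h : Filter.Tendsto (fun u : ℝ => Real.exp (-u * y)) Filter.atTop (nhds 0) := by
      simpa [Function.comp_def] using Real.tendsto_exp_neg_atTop_nhds_zero.comp
        (Filter.tendsto_id.atTop_mul_const hy)
    refine h.zero_mul_isBoundedUnder_le ⟨(y + |a|) / (y ^ 2 + a ^ 2), ?_⟩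
    refine Filter.eventually_map.2 (Filter.Eventually.of_forall fun u => ?_)
    simp only [Function.comp_apply, norm_div, norm_neg]
    rw [Real.norm_of_nonneg (by positivity : 0 ≤ y ^ 2 + a ^ 2)]
    refine div_le_div_of_nonneg_right ((norm_add_le _ _).trans (add_le_add ?_ ?_)) (by positivity)
    · rw [norm_mul, Real.norm_of_nonneg hy.le]
      exact mul_le_of_le_one_right hy.le (Real.abs_sin_le_one _)
    · rw [norm_mul]
      exact mul_le_of_le_one_right (norm_nonneg _) (Real.abs_cos_le_one _)
  rw [integral_Ioi_of_hasDerivAt_of_tendsto' hd hi hlim]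
  simp
  ring

theorem integral_exp_mul_dawson {y : ℝ} (hy : 0 < y) :
    ∫ u in Ioi (0 : ℝ), Real.exp (-u * y) * dawson (u / √2) =
      ∫ t in Ioi (0 : ℝ), Real.exp (-t ^ 2) * (√2 * t / (y ^ 2 + 2 * t ^ 2)) := by
  have hs : (√2) ^ 2 = 2 := Real.sq_sqrt zero_le_two
  have hexp : IntegrableOn (fun u : ℝ => Real.exp (-u * y)) (Ioi 0) := by
    simpa using integrableOn_exp_neg_mul_div one_pos hy
  have hprod : Integrable (Function.uncurry fun u t : ℝ =>
      Real.exp (-u * y) * (Real.exp (-t ^ 2) * Real.sin (2 * (u / √2) * t)))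
      ((volume.restrict (Ioi 0)).prod (volume.restrict (Ioi 0))) := by
    have h := (Integrable.mul_prod hexp
      (integrable_exp_neg_sq.integrableOn (s := Ioi 0))).mul_bdd (c := 1)
      (g := fun p : ℝ × ℝ => Real.sin (2 * (p.1 / √2) * p.2))
      (Continuous.aestronglyMeasurable (by fun_prop)) (ae_of_all _ fun _ => Real.abs_sin_le_one _)
    refine h.congr (ae_of_all _ fun p => ?_)
    simp only [Function.uncurry]
    ring
  simp_rw [dawson_eq_integral_sin, ← integral_const_mul]
  rw [integral_integral_swap hprod]
  refine integral_congr_ae (ae_of_all _ fun t => ?_)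
  simp only []
  rw [show √2 * t / (y ^ 2 + 2 * t ^ 2) = √2 * t / (y ^ 2 + (√2 * t) ^ 2) by rw [mul_pow, hs],
    ← integral_exp_neg_mul_mul_sin hy, ← integral_const_mul]
  refine integral_congr_ae (ae_of_all _ fun u => ?_)
  have h2 : 2 * (u / √2) * t = √2 * t * u := by
    field_simp
    rw [hs]
    ring
  simp only [h2]
  ring

/-- The horseshoe density is a multiple of a Laplace transform of the Dawson function. -/
theorem pHS_eq {τ x : ℝ} (hτ : 0 < τ) (hx : 0 < x) :
    pHS τ x = (√(2 * π))⁻¹ * (2 / π) * (√2 / τ) *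
      ∫ u in Ioi (0 : ℝ), Real.exp (-u * x / τ) * dawson (u / √2) := by
  have hs : (√2) ^ 2 = 2 := Real.sq_sqrt zero_le_two
  have hy : 0 < x / τ := div_pos hx hτ
  have hL := integral_exp_mul_dawson hy
  simp_rw [mul_div_assoc] at hL ⊢
  rw [hL, pHS, ← integral_const_mul]
  set c := x / τ / √2 with hc
  have hc0 : 0 < c := by positivity
  have himg : (fun t : ℝ => c / t) '' Ioi 0 = Ioi 0 := by
    ext l
    constructor
    · rintro ⟨t, ht, rfl⟩
      exact div_pos hc0 ht
    · intro hl
      exact ⟨c / l, div_pos hc0 hl, div_div_cancel₀ hc0.ne'⟩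
  have hinj : InjOn (fun t : ℝ => c / t) (Ioi 0) := by
    intro s _ t _ h
    exact inv_injective (mul_left_cancel₀ hc0.ne' (by simpa only [div_eq_mul_inv] using h))
  have hd : ∀ t ∈ Ioi (0 : ℝ), HasDerivWithinAt (fun t : ℝ => c / t) (-c / t ^ 2) (Ioi 0) t := by
    intro t ht
    have h := ((hasDerivAt_inv (ne_of_gt ht)).const_mul c).hasDerivWithinAt (s := Ioi 0)
    simp only [← div_eq_mul_inv] at h
    exact h.congr_deriv (by ring)
  rw [← himg, integral_image_eq_integral_abs_deriv_smul measurableSet_Ioi hd hinj, himg]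
  refine setIntegral_congr_fun measurableSet_Ioi fun t ht => ?_
  have ht' : 0 < t := ht
  have hcx : c ^ 2 = x ^ 2 / (τ ^ 2 * 2) := by
    rw [hc, div_pow, div_pow, hs]
    field_simp
  have he : -x ^ 2 / (2 * (c / t) ^ 2 * τ ^ 2) = -t ^ 2 := by
    rw [div_pow, hcx]
    field_simp
  have habs : |-c / t ^ 2| = c / t ^ 2 := by
    rw [neg_div, abs_neg, abs_of_pos (by positivity)]
  simp only [he, habs, smul_eq_mul]
  have hr : (1 + (c / t) ^ 2)⁻¹ = 2 * t ^ 2 / ((x / τ) ^ 2 + 2 * t ^ 2) := by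
    rw [div_pow, hcx]
    field_simp
    ring
  rw [hr]
  field_simp
  exact hs.symm

/-- Ratio-of-Laplace-transforms representation of the derivative of the horseshoe penalty. -/
theorem horseshoe_penalty_deriv_ratio (τ : ℝ) (hτ : 0 < τ) (x : ℝ) (hx : 0 < x) :
    IntegrableOn (fun u => (u / τ) * Real.exp (-u * x / τ) * dawson (u / Real.sqrt 2)) (Ioi 0) ∧
    IntegrableOn (fun u => Real.exp (-u * x / τ) * dawson (u / Real.sqrt 2)) (Ioi 0) ∧
    0 < (∫ u in Ioi (0:ℝ), Real.exp (-u * x / τ) * dawson (u / Real.sqrt 2)) ∧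
    -(deriv (pHS τ) x) / pHS τ x =
      (∫ u in Ioi (0:ℝ), (u / τ) * Real.exp (-u * x / τ) * dawson (u / Real.sqrt 2)) /
        ∫ u in Ioi (0:ℝ), Real.exp (-u * x / τ) * dawson (u / Real.sqrt 2) := by
  have hcont : Continuous fun u : ℝ => dawson (u / √2) := continuous_dawson.comp (by fun_prop)
  have hbdd : ∀ u : ℝ, |dawson (u / √2)| ≤ ∫ t in Ioi (0 : ℝ), Real.exp (-t ^ 2) :=
    fun u => abs_dawson_le _
  obtain ⟨hint, hder⟩ := hasDerivAt_laplace_of_bounded hcont hbdd hτ hx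
  have hint₀ : IntegrableOn (fun u => Real.exp (-u * x / τ) * dawson (u / √2)) (Ioi 0) :=
    Integrable.mul_bdd (integrableOn_exp_neg_mul_div hτ hx) hcont.aestronglyMeasurable
      (ae_of_all _ hbdd)
  have hpos : ∀ u ∈ Ioi (0 : ℝ), 0 < Real.exp (-u * x / τ) * dawson (u / √2) := fun u hu =>
    mul_pos (Real.exp_pos _) (dawson_pos (div_pos hu (by positivity)))
  have hpos_int : 0 < ∫ u in Ioi (0 : ℝ), Real.exp (-u * x / τ) * dawson (u / √2) := by
    refine (setIntegral_pos_iff_support_of_nonneg_ae ((ae_restrict_iff' measurableSet_Ioi).2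
      (ae_of_all _ fun u hu => (hpos u hu).le)) hint₀).2 ?_
    have hsub : Ioi 0 ⊆ Function.support fun u => Real.exp (-u * x / τ) * dawson (u / √2) :=
      fun u hu => (hpos u hu).ne'
    rw [inter_eq_self_of_subset_right hsub]
    simp
  refine ⟨by simpa using hint.neg, hint₀, hpos_int, ?_⟩
  have hderiv : deriv (pHS τ) x = (√(2 * π))⁻¹ * (2 / π) * (√2 / τ) *
      ∫ u in Ioi (0 : ℝ), -(u / τ * Real.exp (-u * x / τ) * dawson (u / √2)) := by
    refine ((hder.const_mul _).congr_of_eventuallyEq ?_).deriv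
    filter_upwards [Ioi_mem_nhds hx] with z hz using pHS_eq hτ hz
  rw [hderiv, pHS_eq hτ hx, integral_neg, mul_neg, neg_neg,
    mul_div_mul_left _ _ (by positivity)]
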